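/- In a state machine where writes append records with timestamps assigned from a strictly increasing counter, every reachable LSM state has all record timestamps pairwise distinct. -/

import Mathlib

abbrev Rec := ℕ × ℕ × ℕ

/-- A state: the levels (finite multisets of records) and the timestamp
counter. -/
abbrev CState := (ℕ → Multiset Rec) × ℕ

/-- Transitions: a write adds a record timestamped with the current counter to
level 0 and increments the counter; a compaction moves the union of levels
`i` and `i+1` to level `i+1`. -/
inductive CStep : CState → CState → Prop
  | write (s : CState) (k v : ℕ) :
      CStep s (fun j => if j = 0 then (k, v, s.2) ::ₘ s.1 0 else s.1 j, s.2 + 1)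
  | compaction (s : CState) (i : ℕ) :
      CStep s (fun j => if j = i then 0
        else if j = i + 1 then s.1 i + s.1 (i + 1) else s.1 j, s.2)

def CReachable (s : CState) : Prop :=
  Relation.ReflTransGen CStep (fun _ => (0 : Multiset Rec), 0) s

/-- In every reachable state, all record timestamps are pairwise distinct
(across levels and within a level, counting multiplicity) and all are strictly
below the counter. -/
theorem reachable_timestamps_distinct (s : CState) (hs : CReachable s) :
    (∀ i, ∀ r ∈ s.1 i, r.2.2 < s.2) ∧
    (∀ i, ((s.1 i).map (fun r => r.2.2)).Nodup) ∧
    (∀ i j, i ≠ j → ∀ r ∈ s.1 i, ∀ r' ∈ s.1 j, r.2.2 ≠ r'.2.2) := by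
  unfold CReachable at hs
  induction hs with
  | refl => simp
  | tail _ hstep ih =>
    obtain ⟨h1, h2, h3⟩ := ih
    cases hstep with
    | write k v =>
      rename_i b _
      have key : ∀ j r, r ∈ (if j = 0 then (k, v, b.2) ::ₘ b.1 0 else b.1 j) →
          (j = 0 ∧ r.2.2 = b.2) ∨ r ∈ b.1 j := by
        intro j r hr
        split_ifs at hr with h
        · subst h
          rcases Multiset.mem_cons.1 hr with h | h
          · left; simp [h]
          · right; exact h
        · right; exact hr
      refine ⟨?_, ?_, ?_⟩
      · intro j r hr
        show r.2.2 < b.2 + 1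
        rcases key j r hr with h | h
        · omega
        · have := h1 j r h
          omega
      · intro j
        dsimp only
        split_ifs with h
        · rw [Multiset.map_cons, Multiset.nodup_cons]
          refine ⟨?_, h2 0⟩
          intro hm
          obtain ⟨r, hr, he⟩ := Multiset.mem_map.1 hm
          have := h1 0 r hr
          dsimp only at he
          omega
        · exact h2 j
      · intro i j hij r hr r' hr'
        rcases key i r hr with h | h <;> rcases key j r' hr' with h' | h'
        · omega
        · have := h1 j r' h'
          omega
        · have := h1 i r h
          omega
        · exact h3 i j hij r h r' h'
    | compaction m =>
      rename_i b _
      have key : ∀ j r, r ∈ (if j = m then 0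
          else if j = m + 1 then b.1 m + b.1 (m + 1) else b.1 j) →
          ∃ j', r ∈ b.1 j' ∧ ((j' = j ∧ j ≠ m) ∨ (j' = m ∧ j = m + 1)) := by
        intro j r hr
        split_ifs at hr with h h'
        · simp at hr
        · subst h'
          rcases Multiset.mem_add.1 hr with h | h
          · exact ⟨m, h, by omega⟩
          · exact ⟨m + 1, h, by omega⟩
        · exact ⟨j, hr, by omega⟩
      refine ⟨?_, ?_, ?_⟩
      · intro j r hr
        obtain ⟨j', h, _⟩ := key j r hr
        exact h1 j' r h
      · intro j
        dsimp only
        split_ifs with h h'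
        · simp
        · rw [Multiset.map_add, Multiset.nodup_add]
          refine ⟨h2 m, h2 (m + 1), ?_⟩
          rw [Multiset.disjoint_left]
          intro x hx hx'
          obtain ⟨r, hr, he⟩ := Multiset.mem_map.1 hx
          obtain ⟨r', hr', he'⟩ := Multiset.mem_map.1 hx'
          exact h3 m (m + 1) (by omega) r hr r' hr' (he.trans he'.symm)
        · exact h2 j
      · intro i j hij r hr r' hr'
        obtain ⟨i', h, hi⟩ := key i r hr
        obtain ⟨j', h', hj⟩ := key j r' hr'
        exact h3 i' j' (by omega) r h r' h'
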